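/- arXiv:0803.0691 — 2 statements merged into one kernel-verified Lean document; each statement's English description precedes it below -/
import Mathlib

section
/- With x̃ = 1/(q²x), the following identity of rational functions in x holds: P_μ(x)P_μ(x̃) + Q_{−μ}(x)P_μ(x̃) + P_{−μ}(x)Q_{−μ}(x̃) + Q_μ(x)Q_{−μ}(x̃) = 1. -/
noncomputable section
open scoped Classical

namespace WMDSPQ

/-- `𝒫(t)` with exponent data `(l, μ, m)`:
`𝒫_μ(t) = (qt)^{l+1−(μ)_m}·(1−1/q)/(1−(qt)^m/q)`, an element of `ℂ(x)`. -/
def Pfun (q m l : ℕ) (μ : ℤ) (t : RatFunc ℂ) : RatFunc ℂ :=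
  ((q : RatFunc ℂ) * t) ^ ((l : ℤ) + 1 - μ % (m : ℤ)) * (1 - 1 / (q : RatFunc ℂ))
    / (1 - ((q : RatFunc ℂ) * t) ^ (m : ℤ) / (q : RatFunc ℂ))

/-- `𝒬(t)` with coefficient `c`:  `−c·(qt)^{l+1−m}·(1−(qt)^m)/(1−(qt)^m/q)`. -/
def Qfun (q m l : ℕ) (c : ℂ) (t : RatFunc ℂ) : RatFunc ℂ :=
  - algebraMap ℂ (RatFunc ℂ) c * ((q : RatFunc ℂ) * t) ^ ((l : ℤ) + 1 - (m : ℤ))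
    * (1 - ((q : RatFunc ℂ) * t) ^ (m : ℤ))
    / (1 - ((q : RatFunc ℂ) * t) ^ (m : ℤ) / (q : RatFunc ℂ))

theorem aux_X_pow_ne (m : ℕ) (hm : 1 ≤ m) (c : ℂ) :
    (RatFunc.X : RatFunc ℂ) ^ m ≠ algebraMap ℂ (RatFunc ℂ) c := by
  intro h
  have h2 : algebraMap (Polynomial ℂ) (RatFunc ℂ) (Polynomial.X ^ m)
      = algebraMap (Polynomial ℂ) (RatFunc ℂ) (Polynomial.C c) := by
    rw [map_pow, RatFunc.algebraMap_X, h, RatFunc.algebraMap_C, RatFunc.algebraMap_eq_C]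
  have h3 := RatFunc.algebraMap_injective ℂ h2
  have h4 := congrArg Polynomial.natDegree h3
  rw [Polynomial.natDegree_X_pow, Polynomial.natDegree_C] at h4
  omega

theorem aux_field {K : Type*} [Field K] (y a u v : K) (m : ℕ) (L r r' : ℤ) (hy : y ≠ 0)
    (hD : 1 - y ^ (m : ℤ) * a ≠ 0) (hD' : 1 - (y⁻¹) ^ (m : ℤ) * a ≠ 0)
    (h : (r = 0 ∧ r' = 0 ∧ u = -1 ∧ v = -1) ∨ (r' = m - r ∧ u * v = a)) :
    (y ^ (L - r) * (1 - a) / (1 - y ^ (m : ℤ) * a))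
        * (y⁻¹ ^ (L - r) * (1 - a) / (1 - y⁻¹ ^ (m : ℤ) * a))
      + (-v * y ^ (L - m) * (1 - y ^ (m : ℤ)) / (1 - y ^ (m : ℤ) * a))
        * (y⁻¹ ^ (L - r) * (1 - a) / (1 - y⁻¹ ^ (m : ℤ) * a))
      + (y ^ (L - r') * (1 - a) / (1 - y ^ (m : ℤ) * a))
        * (-v * y⁻¹ ^ (L - m) * (1 - y⁻¹ ^ (m : ℤ)) / (1 - y⁻¹ ^ (m : ℤ) * a))
      + (-u * y ^ (L - m) * (1 - y ^ (m : ℤ)) / (1 - y ^ (m : ℤ) * a))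
        * (-v * y⁻¹ ^ (L - m) * (1 - y⁻¹ ^ (m : ℤ)) / (1 - y⁻¹ ^ (m : ℤ) * a)) = 1 := by
  have hY : y ^ (m : ℤ) ≠ 0 := zpow_ne_zero _ hy
  have hL : y ^ L ≠ 0 := zpow_ne_zero _ hy
  have hr : y ^ r ≠ 0 := zpow_ne_zero _ hy
  rcases h with ⟨rfl, rfl, rfl, rfl⟩ | ⟨rfl, huv⟩
  · simp only [inv_zpow, zpow_sub₀ hy, zpow_zero] at *
    generalize y ^ (m : ℤ) = Y at *
    generalize y ^ L = Z at *
    have hE : Y - a ≠ 0 := by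
      intro h0; apply hD'; field_simp; rw [h0]; simp
    have e : 1 - Y⁻¹ * a = (Y - a) / Y := by field_simp
    rw [e]
    obtain ⟨D, hDe⟩ : ∃ D, D = 1 - Y * a := ⟨_, rfl⟩
    rw [← hDe] at hD ⊢
    field_simp
    rw [hDe]
    ring
  · simp only [inv_zpow, zpow_sub₀ hy] at *
    generalize y ^ (m : ℤ) = Y at *
    generalize y ^ L = Z at *
    generalize y ^ r = R at *
    subst huv
    have hE : Y - u * v ≠ 0 := by
      intro h0; apply hD'; field_simp; rw [h0]; simp
    have e : 1 - Y⁻¹ * (u * v) = (Y - u * v) / Y := by field_simp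
    rw [e]
    obtain ⟨D, hDe⟩ : ∃ D, D = 1 - Y * (u * v) := ⟨_, rfl⟩
    rw [← hDe] at hD ⊢
    field_simp
    rw [hDe]
    ring

/-- With `x̃ = 1/(q²x)`,
`𝒫_μ(x)𝒫_μ(x̃) + 𝒬_{−μ}(x)𝒫_μ(x̃) + 𝒫_{−μ}(x)𝒬_{−μ}(x̃) + 𝒬_μ(x)𝒬_{−μ}(x̃) = 1`,
where `𝒬_μ` has coefficient `u` and `𝒬_{−μ}` has coefficient `v`. -/
theorem PQ_sum_identity
    (m : ℕ) (hm : 1 ≤ m) (l : ℕ) (q : ℕ) (hq : 0 < q) (μ : ℤ) (u v : ℂ)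
    (huv0 : μ % (m : ℤ) = 0 → u = -1 ∧ v = -1)
    (huv : μ % (m : ℤ) ≠ 0 → u * v = 1 / (q : ℂ)) :
    Pfun q m l μ RatFunc.X * Pfun q m l μ (1 / ((q : RatFunc ℂ) ^ 2 * RatFunc.X))
      + Qfun q m l v RatFunc.X * Pfun q m l μ (1 / ((q : RatFunc ℂ) ^ 2 * RatFunc.X))
      + Pfun q m l (-μ) RatFunc.X * Qfun q m l v (1 / ((q : RatFunc ℂ) ^ 2 * RatFunc.X))
      + Qfun q m l u RatFunc.X * Qfun q m l v (1 / ((q : RatFunc ℂ) ^ 2 * RatFunc.X))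
      = 1 := by
  have hqC : (q : ℂ) ≠ 0 := by exact_mod_cast hq.ne'
  have hqa : (q : RatFunc ℂ) = algebraMap ℂ (RatFunc ℂ) (q : ℂ) := by simp
  have hq0 : (q : RatFunc ℂ) ≠ 0 := by
    rw [hqa]; simpa using hqC
  have hX : (RatFunc.X : RatFunc ℂ) ≠ 0 := RatFunc.X_ne_zero
  have hy : (q : RatFunc ℂ) * RatFunc.X ≠ 0 := mul_ne_zero hq0 hX
  have hinv : (q : RatFunc ℂ) * (1 / ((q : RatFunc ℂ) ^ 2 * RatFunc.X))
      = ((q : RatFunc ℂ) * RatFunc.X)⁻¹ := by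
    field_simp
  unfold Pfun Qfun
  rw [hinv]
  simp only [div_eq_mul_inv (_ ^ (m : ℤ)) (q : RatFunc ℂ), one_div]
  apply aux_field _ _ _ _ _ _ _ _ hy
  · intro h
    apply aux_X_pow_ne m hm ((q : ℂ) * ((q : ℂ) ^ m)⁻¹)
    rw [map_mul, map_inv₀, map_pow, ← hqa]
    rw [zpow_natCast, mul_pow] at h
    field_simp at h ⊢
    linear_combination -h
  · intro h
    apply aux_X_pow_ne m hm ((q : ℂ)⁻¹ * ((q : ℂ) ^ m)⁻¹)
    rw [map_mul, map_inv₀, map_inv₀, map_pow, ← hqa]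
    rw [zpow_natCast, inv_pow, mul_pow] at h
    field_simp at h ⊢
    linear_combination h
  · by_cases h0 : μ % (m : ℤ) = 0
    · left
      obtain ⟨rfl, rfl⟩ := huv0 h0
      refine ⟨h0, ?_, by simp, by simp⟩
      exact Int.emod_eq_zero_of_dvd ((Int.dvd_of_emod_eq_zero h0).neg_right)
    · right
      refine ⟨?_, ?_⟩
      · have h1 : ¬ (m : ℤ) ∣ μ := fun h => h0 (Int.emod_eq_zero_of_dvd h)
        rw [Int.neg_emod, if_neg h1]
        simp
      · rw [← map_mul, huv h0, hqa]
        simp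

end WMDSPQ
end
end

section
/- Suppose μ ≢ 0 mod m. Then, with x̃ = 1/(q²x), the following two identities of rational functions in x hold: Q_{−μ}(x)P_μ(x̃) + P_{−μ}(x)Q_{−μ}(x̃) = 0, and P_μ(x)P_μ(x̃) + Q_μ(x)Q_{−μ}(x̃) = 1. -/
noncomputable section
open scoped Classical

namespace WMDSPQ

/-- A positive power of `X` is not a constant rational function. -/
theorem X_pow_ne_C (m : ℕ) (hm : 1 ≤ m) (c : ℂ) :
    (RatFunc.X : RatFunc ℂ) ^ m ≠ RatFunc.C c := by
  intro h
  rw [← RatFunc.algebraMap_X, ← RatFunc.algebraMap_C, ← map_pow] at h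
  have h2 := RatFunc.algebraMap_injective ℂ h
  have h3 := congrArg Polynomial.natDegree h2
  simp at h3
  omega

/-- The field identities behind the theorem, with `y = qx`. -/
theorem field_identities {K : Type*} [Field K] (m : ℕ) (a r r' : ℤ) (hr : r' = m - r)
    (Q y u v : K) (hQ : Q ≠ 0) (hy : y ≠ 0) (huv : u * v = 1 / Q)
    (h1 : y ^ m ≠ Q) (h2 : Q * y ^ m ≠ 1) :
    ((-v * y ^ (a - m) * (1 - y ^ (m : ℤ)) / (1 - y ^ (m : ℤ) / Q))
        * ((y⁻¹) ^ (a - r) * (1 - 1 / Q) / (1 - (y⁻¹) ^ (m : ℤ) / Q))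
      + (y ^ (a - r') * (1 - 1 / Q) / (1 - y ^ (m : ℤ) / Q))
        * (-v * (y⁻¹) ^ (a - m) * (1 - (y⁻¹) ^ (m : ℤ)) / (1 - (y⁻¹) ^ (m : ℤ) / Q)) = 0) ∧
    ((y ^ (a - r) * (1 - 1 / Q) / (1 - y ^ (m : ℤ) / Q))
        * ((y⁻¹) ^ (a - r) * (1 - 1 / Q) / (1 - (y⁻¹) ^ (m : ℤ) / Q))
      + (-u * y ^ (a - m) * (1 - y ^ (m : ℤ)) / (1 - y ^ (m : ℤ) / Q))
        * (-v * (y⁻¹) ^ (a - m) * (1 - (y⁻¹) ^ (m : ℤ)) / (1 - (y⁻¹) ^ (m : ℤ) / Q)) = 1) := by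
  subst hr
  have e : a - ((m : ℤ) - r) = a + r - m := by ring
  rw [e]
  simp only [zpow_sub₀ hy, zpow_add₀ hy, zpow_sub₀ (inv_ne_zero hy), zpow_natCast, inv_zpow, inv_pow]
  have hA : y ^ a ≠ 0 := zpow_ne_zero _ hy
  have hR : y ^ r ≠ 0 := zpow_ne_zero _ hy
  have hz : y ^ m ≠ 0 := pow_ne_zero _ hy
  generalize y ^ a = A at *
  generalize y ^ r = R at *
  generalize y ^ m = z at *
  have d1 : 1 - z / Q ≠ 0 := by
    intro h
    apply h1
    field_simp at h
    linear_combination -h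
  have d2 : 1 - z⁻¹ / Q ≠ 0 := by
    intro h
    apply h2
    field_simp at h
    linear_combination h
  have key : (1 - 1 / Q) ^ 2 + u * v * (1 - z) * (1 - z⁻¹) = (1 - z / Q) * (1 - z⁻¹ / Q) := by
    rw [huv]
    field_simp
    ring
  generalize 1 - z / Q = D1 at *
  generalize 1 - z⁻¹ / Q = D2 at *
  constructor
  · field_simp
    ring
  · have : ∀ p w : K, A / R * p / D1 * (A⁻¹ / R⁻¹ * p / D2)
        + -u * (A / z) * (1 - z) / D1 * (-v * (A⁻¹ / z⁻¹) * w / D2)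
        = (p ^ 2 + u * v * (1 - z) * w) / (D1 * D2) := by
      intro p w
      field_simp
    rw [this, key, div_self (mul_ne_zero d1 d2)]

/-- Suppose `μ ≢ 0 mod m`.  With `x̃ = 1/(q²x)`:
`𝒬_{−μ}(x)𝒫_μ(x̃) + 𝒫_{−μ}(x)𝒬_{−μ}(x̃) = 0` and
`𝒫_μ(x)𝒫_μ(x̃) + 𝒬_μ(x)𝒬_{−μ}(x̃) = 1`, where `𝒬_μ` has coefficient `u` and `𝒬_{−μ}`
has coefficient `v`, with `uv = 1/q`. -/
theorem PQ_pair_identities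
    (m : ℕ) (hm : 1 ≤ m) (l : ℕ) (q : ℕ) (hq : 0 < q) (μ : ℤ)
    (hμ : μ % (m : ℤ) ≠ 0) (u v : ℂ) (huv : u * v = 1 / (q : ℂ)) :
    (Qfun q m l v RatFunc.X * Pfun q m l μ (1 / ((q : RatFunc ℂ) ^ 2 * RatFunc.X))
      + Pfun q m l (-μ) RatFunc.X * Qfun q m l v (1 / ((q : RatFunc ℂ) ^ 2 * RatFunc.X))
      = 0) ∧
    (Pfun q m l μ RatFunc.X * Pfun q m l μ (1 / ((q : RatFunc ℂ) ^ 2 * RatFunc.X))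
      + Qfun q m l u RatFunc.X * Qfun q m l v (1 / ((q : RatFunc ℂ) ^ 2 * RatFunc.X))
      = 1) := by
  have hqC : (q : ℂ) ≠ 0 := Nat.cast_ne_zero.mpr hq.ne'
  have hcast : (q : RatFunc ℂ) = RatFunc.C (q : ℂ) := (map_natCast RatFunc.C q).symm
  have hQ : (q : RatFunc ℂ) ≠ 0 := by
    rw [hcast]
    exact (map_ne_zero RatFunc.C).mpr hqC
  have hX : (RatFunc.X : RatFunc ℂ) ≠ 0 := RatFunc.X_ne_zero
  have hinv : (q : RatFunc ℂ) * (1 / ((q : RatFunc ℂ) ^ 2 * RatFunc.X))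
      = ((q : RatFunc ℂ) * RatFunc.X)⁻¹ := by
    field_simp
  have hr : (-μ) % (m : ℤ) = (m : ℤ) - μ % (m : ℤ) := by
    have hm0 : (0 : ℤ) < m := by exact_mod_cast hm
    have hlt := Int.emod_lt_of_pos μ hm0
    have hge := Int.emod_nonneg μ hm0.ne'
    have h0 : -μ = ((m : ℤ) - μ % m) + m * (-(μ / m) - 1) := by
      linear_combination Int.emod_add_mul_ediv μ m
    rw [h0, Int.add_mul_emod_self_left]
    exact Int.emod_eq_of_lt (by omega) (by omega)
  have huv' : algebraMap ℂ (RatFunc ℂ) u * algebraMap ℂ (RatFunc ℂ) v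
      = 1 / (q : RatFunc ℂ) := by
    rw [← map_mul, huv]
    simp
  have key := field_identities m ((l : ℤ) + 1) (μ % m) ((-μ) % m) hr (q : RatFunc ℂ)
    ((q : RatFunc ℂ) * RatFunc.X) (algebraMap ℂ (RatFunc ℂ) u) (algebraMap ℂ (RatFunc ℂ) v)
    hQ (mul_ne_zero hQ hX) huv'
    (by
      intro h
      apply X_pow_ne_C m hm ((q : ℂ) / (q : ℂ) ^ m)
      rw [map_div₀, map_pow, ← hcast, eq_div_iff (pow_ne_zero _ hQ)]
      rw [mul_pow] at h
      linear_combination h)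
    (by
      intro h
      apply X_pow_ne_C m hm (1 / ((q : ℂ) * (q : ℂ) ^ m))
      rw [map_div₀, map_mul, map_pow, map_one, ← hcast,
        eq_div_iff (mul_ne_zero hQ (pow_ne_zero _ hQ)), ← h, mul_pow]
      ring)
  unfold Pfun Qfun
  rw [hinv]
  exact key

end WMDSPQ
end
end
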